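/- Let S be a semitransitive subsemigroup of the singular part I_n \ S_n with |S| ≤ 2n, let g and h be the two distinct non-zero idempotents of S, and let N = (gSh ∪ hSg) \ {0} (where eSf = {e·σ·f : σ ∈ S} and 0 is the empty map). If t denotes the minimal cardinality of a transitivity block of S, then |N| ≥ n − t. -/

import Mathlib

/-- `ISemi n` is the symmetric inverse semigroup `I_n`, realized as the set of all
partial injective maps (partial permutations) of the `n`-element set `Fin n`,
with composition given by `PEquiv.trans` (apply the left factor first, matching
the right-action convention `x φ`). -/
abbrev ISemi (n : ℕ) := PEquiv (Fin n) (Fin n)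

/-- `S` is a subsemigroup of `I_n`: a subset closed under composition. -/
def IsSubsemigroup {n : ℕ} (S : Set (ISemi n)) : Prop :=
  ∀ a ∈ S, ∀ b ∈ S, a.trans b ∈ S

/-- `φ` belongs to the singular part `I_n \ S_n`: its domain is a proper subset
of the underlying set, i.e. it is undefined somewhere. -/
def IsSingular {n : ℕ} (φ : ISemi n) : Prop :=
  ∃ x : Fin n, φ x = none

/-- `S` is semitransitive: for all `x, y` there is `φ ∈ S` with `φ x = y` or `φ y = x`. -/
def Semitransitive {n : ℕ} (S : Set (ISemi n)) : Prop :=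
  ∀ x y : Fin n, ∃ φ ∈ S, φ x = some y ∨ φ y = some x

/-- The semitransitivity preorder induced by `S`: `x ≥ y` iff some `φ ∈ S` maps `x` to `y`. -/
def STGe {n : ℕ} (S : Set (ISemi n)) (x y : Fin n) : Prop :=
  ∃ φ ∈ S, φ x = some y

/-- The transitivity block of `x`: the equivalence class of `x` under `x ≥ y ∧ y ≥ x`. -/
def STBlock {n : ℕ} (S : Set (ISemi n)) (x : Fin n) : Set (Fin n) :=
  {y | STGe S x y ∧ STGe S y x}

/-- `k`-th power of `φ` under composition (`pePow φ 0` is the identity). -/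
def pePow {n : ℕ} (φ : ISemi n) : ℕ → ISemi n
  | 0 => PEquiv.refl (Fin n)
  | k + 1 => (pePow φ k).trans φ

/-- The multiplication of `I_n` as a monoid structure. -/
abbrev ISemi.monoid (n : ℕ) : Monoid (ISemi n) where
  mul := PEquiv.trans
  one := PEquiv.refl _
  mul_assoc := PEquiv.trans_assoc
  one_mul := PEquiv.refl_trans
  mul_one := PEquiv.trans_refl

/-- `φ ∈ S` has its domain among the fixed points of `g` and its range among those of `h`;
for idempotents `g`, `h` this says `φ ∈ gSh`. -/
def Carries {n : ℕ} (S : Set (ISemi n)) (g h φ : ISemi n) : Prop :=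
  φ ∈ S ∧ ∀ x y, φ x = some y → g x = some x ∧ h y = some y

/-- A semitransitive semigroup containing two complementary partial identities `g` and `h`,
in which an element that can be undone at one fixed point of `g` (or `h`)
can be undone at all of them. -/
structure ComplementaryIdempotents {n : ℕ} (S : Set (ISemi n)) (g h : ISemi n) : Prop where
  sub : IsSubsemigroup S
  st : Semitransitive S
  left_mem : g ∈ S
  right_mem : h ∈ S
  left_eq : ∀ {x y}, g x = some y → x = y
  right_eq : ∀ {x y}, h x = some y → x = y
  cover : ∀ x, g x = some x ∨ h x = some x
  disj : ∀ {x}, g x = some x → h x = some x → False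
  left_undo : ∀ {α x z}, α ∈ S → g x = some x → α x = some z → STGe S z x →
    ∀ w, g w = some w → ∃ v, α w = some v ∧ STGe S v w
  right_undo : ∀ {α x z}, α ∈ S → h x = some x → α x = some z → STGe S z x →
    ∀ w, h w = some w → ∃ v, α w = some v ∧ STGe S v w

theorem exists_isLeast_of_total {X : Type*} [Finite X] (R : X → X → Prop)
    (total : ∀ x y, R x y ∨ R y x) (trans : ∀ {x y z}, R x y → R y z → R x z)
    (P : X → Prop) (hP : ∃ x, P x) : ∃ m, P m ∧ ∀ x, P x → R m x := by
  classical
  have key : ∀ s : Finset X, s.Nonempty → ∃ m ∈ s, ∀ x ∈ s, R m x := by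
    intro s hs
    induction hs using Finset.Nonempty.cons_induction with
    | singleton a => exact ⟨a, by simp, by simpa using (total a a)⟩
    | cons a s ha hs ih =>
      obtain ⟨m, hm, hmin⟩ := ih
      rcases total a m with h | h
      · refine ⟨a, by simp, fun x hx => ?_⟩
        rcases Finset.mem_cons.1 hx with rfl | hx
        · simpa using total x x
        · exact trans h (hmin x hx)
      · refine ⟨m, by simp [hm], fun x hx => ?_⟩
        rcases Finset.mem_cons.1 hx with rfl | hx
        · exact h
        · exact hmin x hx
  obtain ⟨x, hx⟩ := hP
  obtain ⟨m, hm, hmin⟩ := key (Set.toFinite {x | P x}).toFinset ⟨x, by simpa using hx⟩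
  exact ⟨m, by simpa using hm, fun y hy => hmin y (by simpa using hy)⟩

theorem STGe.trans {n : ℕ} {S : Set (ISemi n)} (hS : IsSubsemigroup S) {x y z : Fin n}
    (hxy : STGe S x y) (hyz : STGe S y z) : STGe S x z := by
  obtain ⟨φ, hφ, h1⟩ := hxy
  obtain ⟨ψ, hψ, h2⟩ := hyz
  exact ⟨φ.trans ψ, hS _ hφ _ hψ, (PEquiv.trans_eq_some _ _ _ _).2 ⟨y, h1, h2⟩⟩

theorem Semitransitive.total {n : ℕ} {S : Set (ISemi n)} (hS : Semitransitive S) (x y : Fin n) :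
    STGe S x y ∨ STGe S y x := by
  obtain ⟨φ, hφ, h | h⟩ := hS x y
  · exact Or.inl ⟨φ, hφ, h⟩
  · exact Or.inr ⟨φ, hφ, h⟩

theorem PEquiv.eq_of_trans_self_eq {X : Type*} {g : PEquiv X X} (hg : g.trans g = g) {x y : X}
    (h : g x = some y) : x = y := by
  have h' := h
  rw [← hg, PEquiv.trans_eq_some] at h'
  obtain ⟨b, hb, hby⟩ := h'
  obtain rfl : y = b := Option.some.inj (h.symm.trans hb)
  exact g.inj h hby

/-- In a finite monoid every element has a positive power that is idempotent. -/
theorem exists_pow_succ_isIdempotentElem {M : Type*} [Monoid M] [Finite M] (a : M) :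
    ∃ k : ℕ, IsIdempotentElem (a ^ (k + 1)) := by
  obtain ⟨i, j, hij, he⟩ : ∃ i j : ℕ, i < j ∧ a ^ i = a ^ j := by
    obtain ⟨i, j, hne, he⟩ := Finite.exists_ne_map_eq_of_infinite (fun k : ℕ => a ^ k)
    rcases lt_or_gt_of_ne hne with h | h
    · exact ⟨i, j, h, he⟩
    · exact ⟨j, i, h, he.symm⟩
  obtain ⟨d, rfl⟩ := Nat.exists_eq_add_of_lt hij
  have period : ∀ k l : ℕ, a ^ (i + l + k * (d + 1)) = a ^ (i + l) := by
    intro k l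
    induction k with
    | zero => simp
    | succ k ih =>
      have h1 : i + l + (k + 1) * (d + 1) = (i + d + 1) + (l + k * (d + 1)) := by ring
      have h2 : i + l + k * (d + 1) = i + (l + k * (d + 1)) := by ring
      rw [h1, pow_add, ← he, ← pow_add, ← h2, ih]
  refine ⟨(i + 1) * d + i, ?_⟩
  have h1 : (i + 1) * d + i + 1 = i + ((i + 1) * d + 1) := by ring
  have h2 : (i + 1) * d + i + 1 + ((i + 1) * d + i + 1) =
      i + ((i + 1) * d + 1) + (i + 1) * (d + 1) := by ring
  rw [IsIdempotentElem, ← pow_add, h2, period, ← h1]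

instance ISemi.finite (n : ℕ) : Finite (ISemi n) := DFunLike.finite _

theorem exists_idempotent_of_fixed {n : ℕ} {S : Set (ISemi n)} (hS : IsSubsemigroup S)
    {α : ISemi n} {x z : Fin n} (hα : α ∈ S) (hxz : α x = some z) (hzx : STGe S z x) :
    ∃ β ∈ S, (α.trans β).trans (α.trans β) = α.trans β ∧ (α.trans β) x = some x := by
  let := ISemi.monoid n
  have hmul : ∀ a b : ISemi n, a * b = a.trans b := fun _ _ => rfl
  obtain ⟨γ, hγ, hγz⟩ := hzx
  obtain ⟨k, hid⟩ := exists_pow_succ_isIdempotentElem (α * γ)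
  have tail : ∀ j : ℕ, γ * (α * γ) ^ j ∈ S := by
    intro j
    induction j with
    | zero => simpa using hγ
    | succ j ih =>
      rw [pow_succ, ← mul_assoc]
      exact hS _ ih _ (hS _ hα _ hγ)
  have fixed : ∀ j : ℕ, ((α * γ) ^ j) x = some x := by
    intro j
    induction j with
    | zero => rfl
    | succ j ih =>
      rw [pow_succ, hmul, PEquiv.trans_eq_some]
      exact ⟨x, ih, (PEquiv.trans_eq_some _ _ _ _).2 ⟨z, hxz, hγz⟩⟩
  have split : (α * γ) ^ (k + 1) = α.trans (γ * (α * γ) ^ k) := by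
    rw [pow_succ', mul_assoc]; rfl
  rw [split] at hid
  exact ⟨_, tail k, hid, split ▸ fixed (k + 1)⟩

theorem undo_of_unique_idempotent {n : ℕ} {S : Set (ISemi n)} (hS : IsSubsemigroup S)
    {g : ISemi n} {x : Fin n} (hgx : ∀ e ∈ S, e.trans e = e → e x = some x → e = g)
    {α : ISemi n} {z : Fin n} (hα : α ∈ S) (hxz : α x = some z) (hzx : STGe S z x)
    (w : Fin n) (hw : g w = some w) : ∃ v, α w = some v ∧ STGe S v w := by
  obtain ⟨β, hβ, hid, hfix⟩ := exists_idempotent_of_fixed hS hα hxz hzx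
  rw [← hgx _ (hS _ hα _ hβ) hid hfix, PEquiv.trans_eq_some] at hw
  obtain ⟨v, hv, hvw⟩ := hw
  exact ⟨v, hv, β, hβ, hvw⟩

theorem Carries.mem_sandwich {n : ℕ} {S : Set (ISemi n)} {g h φ : ISemi n}
    (hφ : Carries S g h φ) : ∃ σ ∈ S, φ = g.trans (σ.trans h) := by
  refine ⟨φ, hφ.1, PEquiv.ext fun x => Option.ext fun y => ?_⟩
  simp only [PEquiv.trans_eq_some]
  constructor
  · intro hy
    obtain ⟨h1, h2⟩ := hφ.2 x y hy
    exact ⟨x, h1, y, hy, h2⟩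
  · rintro ⟨a, ha, b, hb, hby⟩
    obtain ⟨h1, h2⟩ := hφ.2 a b hb
    rw [h2] at hby
    cases hby
    rwa [g.inj ha h1]

namespace ComplementaryIdempotents

variable {n : ℕ} {S : Set (ISemi n)} {g h : ISemi n}

theorem symm (H : ComplementaryIdempotents S g h) : ComplementaryIdempotents S h g where
  sub := H.sub
  st := H.st
  left_mem := H.right_mem
  right_mem := H.left_mem
  left_eq := H.right_eq
  right_eq := H.left_eq
  cover x := (H.cover x).symm
  disj hx hy := H.disj hy hx
  left_undo := H.right_undo
  right_undo := H.left_undo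

theorem refl (H : ComplementaryIdempotents S g h) (x : Fin n) : STGe S x x := by
  rcases H.cover x with hx | hx
  · exact ⟨g, H.left_mem, hx⟩
  · exact ⟨h, H.right_mem, hx⟩

theorem trans (H : ComplementaryIdempotents S g h) {x y z : Fin n}
    (hxy : STGe S x y) (hyz : STGe S y z) : STGe S x z := STGe.trans H.sub hxy hyz

theorem ge_of_not (H : ComplementaryIdempotents S g h) {x y : Fin n} (hxy : ¬STGe S x y) :
    STGe S y x := (H.st.total x y).resolve_left hxy

theorem carries_restrict (hS : IsSubsemigroup S) {e f : ISemi n} (he : e ∈ S) (hf : f ∈ S)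
    (he' : ∀ {x y}, e x = some y → x = y) (hf' : ∀ {x y}, f x = some y → x = y)
    {x y : Fin n} (hx : e x = some x) (hy : f y = some y) (hxy : STGe S x y) :
    ∃ φ, Carries S e f φ ∧ φ x = some y := by
  obtain ⟨σ, hσ, hσx⟩ := hxy
  refine ⟨e.trans (σ.trans f), ⟨hS _ he _ (hS _ hσ _ hf), fun a b hab => ?_⟩, ?_⟩
  · simp only [PEquiv.trans_eq_some] at hab
    obtain ⟨c, hc, d, -, hd⟩ := hab
    obtain rfl := he' hc
    obtain rfl := hf' hd
    exact ⟨hc, hd⟩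
  · simp only [PEquiv.trans_eq_some]
    exact ⟨x, hx, y, hσx, hy⟩

theorem exists_carries (H : ComplementaryIdempotents S g h) {x y : Fin n}
    (hx : g x = some x) (hy : h y = some y) (hxy : STGe S x y) :
    ∃ φ, Carries S g h φ ∧ φ x = some y :=
  carries_restrict H.sub H.left_mem H.right_mem H.left_eq H.right_eq hx hy hxy

/-- Elements of `gSg` composed along a saturated chain of blocks from `x` down to `z` push every
block down by at least as many levels. -/
theorem exists_level_monotone (H : ComplementaryIdempotents S g h) {x z : Fin n}
    (hx : g x = some x) (hz : g z = some z) (hxz : STGe S x z) :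
    ∃ α, Carries S g g α ∧ α x = some z ∧ ∀ x' z', α x' = some z' →
      (STGe S z' z → STGe S x' x) ∧ (STGe S x x' → STGe S z z') := by
  induction hN : {w | g w = some w ∧ (STGe S x w ∧ ¬STGe S w x) ∧
    (STGe S w z ∧ ¬STGe S z w)}.ncard using Nat.strong_induction_on generalizing x z with
  | _ N ih =>
  by_cases hmid : ∃ w, g w = some w ∧ (STGe S x w ∧ ¬STGe S w x) ∧ (STGe S w z ∧ ¬STGe S z w)
  · obtain ⟨w, hw, ⟨hxw, hwx⟩, hwz, hzw⟩ := hmid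
    obtain ⟨α, hα, hαx, hα'⟩ := ih _ (by
      rw [← hN]
      refine Set.ncard_lt_ncard ⟨?_, fun hsub => ?_⟩ (Set.toFinite _)
      · rintro v ⟨hv, h1, h2, h3⟩
        exact ⟨hv, h1, H.trans h2 hwz, fun h4 => h3 (H.trans hwz h4)⟩
      · exact (hsub (show w ∈ _ from ⟨hw, ⟨hxw, hwx⟩, hwz, hzw⟩)).2.2.2 (H.refl w))
      hx hw hxw rfl
    obtain ⟨β, hβ, hβw, hβ'⟩ := ih _ (by
      rw [← hN]
      refine Set.ncard_lt_ncard ⟨?_, fun hsub => ?_⟩ (Set.toFinite _)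
      · rintro v ⟨hv, ⟨h1, h2⟩, h3⟩
        exact ⟨hv, ⟨H.trans hxw h1, fun h4 => h2 (H.trans h4 hxw)⟩, h3⟩
      · exact (hsub (show w ∈ _ from ⟨hw, ⟨hxw, hwx⟩, hwz, hzw⟩)).2.1.2 (H.refl w))
      hw hz hwz rfl
    refine ⟨α.trans β, ⟨H.sub _ hα.1 _ hβ.1, fun a b hab => ?_⟩, ?_, fun a b hab => ?_⟩
    · obtain ⟨c, hc, hcb⟩ := (PEquiv.trans_eq_some _ _ _ _).1 hab
      exact ⟨(hα.2 _ _ hc).1, (hβ.2 _ _ hcb).2⟩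
    · exact (PEquiv.trans_eq_some _ _ _ _).2 ⟨w, hαx, hβw⟩
    · obtain ⟨c, hc, hcb⟩ := (PEquiv.trans_eq_some _ _ _ _).1 hab
      exact ⟨fun hb => (hα' _ _ hc).1 ((hβ' _ _ hcb).1 hb),
        fun ha => (hβ' _ _ hcb).2 ((hα' _ _ hc).2 ha)⟩
  · obtain ⟨α, hα, hαx⟩ := carries_restrict H.sub H.left_mem H.left_mem H.left_eq H.left_eq
      hx hz hxz
    refine ⟨α, hα, hαx, fun a b hab => ?_⟩
    obtain ⟨hga, hgb⟩ := hα.2 _ _ hab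
    have hge : STGe S a b := ⟨α, hα.1, hab⟩
    by_cases hzx : STGe S z x
    · exact ⟨fun hbz => H.trans hge (H.trans hbz hzx),
        fun hxa => H.trans hzx (H.trans hxa hge)⟩
    · have hba : ¬STGe S b a := by
        intro hba
        obtain ⟨v, hv, hvx⟩ := H.left_undo hα.1 hga hab hba x hx
        rw [hαx] at hv
        cases hv
        exact hzx hvx
      constructor
      · intro hbz
        by_contra hax
        exact hmid ⟨a, hga, ⟨H.ge_of_not hax, hax⟩, H.trans hge hbz,
          fun hza => hba (H.trans hbz hza)⟩
      · intro hxa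
        by_contra hzb
        exact hmid ⟨b, hgb, ⟨H.trans hxa hge, fun hbx => hba (H.trans hbx hxa)⟩,
          H.ge_of_not hzb, hzb⟩

/-- The non-zero elements of `gSh ∪ hSg`. -/
def offDiagonal (S : Set (ISemi n)) (g h : ISemi n) : Set (ISemi n) :=
  {φ : ISemi n | ∃ σ ∈ S, φ = g.trans (σ.trans h) ∨ φ = h.trans (σ.trans g)} \ {⊥}

theorem offDiagonal_comm : offDiagonal S g h = offDiagonal S h g := by
  ext φ
  simp only [offDiagonal, or_comm]

theorem mem_offDiagonal {φ : ISemi n} (hφ : Carries S g h φ) {x y : Fin n}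
    (hxy : φ x = some y) : φ ∈ offDiagonal S g h := by
  obtain ⟨σ, hσ, he⟩ := hφ.mem_sandwich
  refine ⟨⟨σ, hσ, Or.inl he⟩, ?_⟩
  rintro rfl
  simp at hxy

theorem le_ncard_offDiagonal_of_mixed (H : ComplementaryIdempotents S g h) {a b : Fin n}
    (ha : g a = some a) (hb : h b = some b) (hab : STGe S a b) (hba : STGe S b a)
    {u : Fin n} (hu : g u = some u) (hmax : ∀ x, STGe S u x) :
    n ≤ (offDiagonal S g h).ncard := by
  obtain ⟨φ, hφ, hφa⟩ := H.exists_carries ha hb hab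
  obtain ⟨v, hv, hvu⟩ := H.left_undo hφ.1 ha hφa hba u hu
  have hhv := (hφ.2 _ _ hv).2
  have ex : ∀ z, ∃ ψ ∈ offDiagonal S g h, (Carries S g h ψ ∧ ψ u = some z) ∨
      (Carries S h g ψ ∧ ψ v = some z) := by
    intro z
    rcases H.cover z with hz | hz
    · obtain ⟨ψ, hψ, h1⟩ := H.symm.exists_carries hhv hz (H.trans hvu (hmax z))
      exact ⟨ψ, offDiagonal_comm ▸ mem_offDiagonal hψ h1, Or.inr ⟨hψ, h1⟩⟩
    · obtain ⟨ψ, hψ, h1⟩ := H.exists_carries hu hz (hmax z)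
      exact ⟨ψ, mem_offDiagonal hψ h1, Or.inl ⟨hψ, h1⟩⟩
  choose f hfN hf using ex
  have := Set.ncard_le_ncard_of_injOn (s := Set.univ) f (fun z _ => hfN z) (by
    intro z _ z' _ hzz
    have h1 := hf z
    have h2 := hf z'
    rw [← hzz] at h2
    rcases h1 with ⟨c1, h1⟩ | ⟨c1, h1⟩ <;> rcases h2 with ⟨c2, h2⟩ | ⟨c2, h2⟩
    · exact Option.some.inj (h1.symm.trans h2)
    · exact (H.disj (c1.2 _ _ h1).1 (c2.2 _ _ h1).1).elim
    · exact (H.disj (c2.2 _ _ h1).1 (c1.2 _ _ h1).1).elim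
    · exact Option.some.inj (h1.symm.trans h2)) (Set.toFinite _)
  simpa [Set.ncard_univ] using this

/-- Counting along a double star: `E φ x y` says that `φ` is one of the elements attached to the
edge between the blocks of `x` and `y`. Rooting the tree at the block of `r` attaches
distinct elements to all points outside that block. -/
theorem sub_ncard_block_le (H : ComplementaryIdempotents S g h) {N : Set (ISemi n)}
    {E : ISemi n → Fin n → Fin n → Prop} {p q r : Fin n}
    (hN : ∀ {φ x y}, E φ x y → φ ∈ N)
    (left_inj : ∀ {φ x x' y}, E φ x y → E φ x' y → x = x')
    (right_inj : ∀ {φ x y y'}, E φ x y → E φ x y' → y = y')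
    (edge : ∀ {φ x x' y y'}, E φ x y → E φ x' y' → STGe S x x' ∧ STGe S y y')
    (center_right : ∀ x y, g x = some x → STGe S q y → STGe S y q → ∃ φ, E φ x y)
    (center_left : ∀ y, h y = some y → ∃ φ, E φ p y)
    (hr : g r = some r) : n - (STBlock S r).ncard ≤ N.ncard := by
  have ex : ∀ z, ∃ φ, z ∉ STBlock S r → E φ z q ∨
      ((STGe S q z ∧ STGe S z q) ∧ E φ r z) ∨ (¬(STGe S q z ∧ STGe S z q) ∧ E φ p z) := by
    intro z
    rcases H.cover z with hz | hz
    · obtain ⟨φ, hφ⟩ := center_right z q hz (H.refl q) (H.refl q)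
      exact ⟨φ, fun _ => Or.inl hφ⟩
    · by_cases hq : STGe S q z ∧ STGe S z q
      · obtain ⟨φ, hφ⟩ := center_right r z hr hq.1 hq.2
        exact ⟨φ, fun _ => Or.inr (Or.inl ⟨hq, hφ⟩)⟩
      · obtain ⟨φ, hφ⟩ := center_left z hz
        exact ⟨φ, fun _ => Or.inr (Or.inr ⟨hq, hφ⟩)⟩
  choose f hf using ex
  have hle := Set.ncard_le_ncard_of_injOn (s := (STBlock S r)ᶜ) (t := N) f
    (fun z hz => by
      rcases hf z hz with h1 | ⟨-, h1⟩ | ⟨-, h1⟩ <;> exact hN h1)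
    (by
      intro z hz z' hz' hzz
      have h1 := hf z hz
      have h2 := hf z' hz'
      rw [← hzz] at h2
      rcases h1 with h1 | ⟨k1, h1⟩ | ⟨k1, h1⟩ <;> rcases h2 with h2 | ⟨k2, h2⟩ | ⟨k2, h2⟩
      · exact left_inj h1 h2
      · exact (hz ⟨(edge h2 h1).1, (edge h1 h2).1⟩).elim
      · exact (k2 ⟨(edge h1 h2).2, (edge h2 h1).2⟩).elim
      · exact (hz' ⟨(edge h1 h2).1, (edge h2 h1).1⟩).elim
      · exact right_inj h1 h2
      · exact (k2 ⟨H.trans k1.1 (edge h1 h2).2, H.trans (edge h2 h1).2 k1.2⟩).elim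
      · exact (k1 ⟨(edge h2 h1).2, (edge h1 h2).2⟩).elim
      · exact (k1 ⟨H.trans k2.1 (edge h2 h1).2, H.trans (edge h1 h2).2 k2.2⟩).elim
      · exact right_inj h1 h2) (Set.toFinite _)
  have hc := Set.ncard_add_ncard_compl (STBlock S r)
  rw [Nat.card_eq_fintype_card, Fintype.card_fin] at hc
  omega

/-- The elements attached to an edge of the double star with centers the blocks of `p` and `q`. -/
def StarEdge (S : Set (ISemi n)) (g h : ISemi n) (p q : Fin n) (φ : ISemi n) (x y : Fin n) :
    Prop :=
  (Carries S g h φ ∧ φ x = some y ∧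
    (((STGe S q y ∧ STGe S y q) ∧ ∀ x' y', φ x' = some y' → STGe S y' q → STGe S x' x) ∨
    ((STGe S p x ∧ STGe S x p) ∧ ¬STGe S y q ∧ ∀ x' y', φ x' = some y' → STGe S y y'))) ∨
  (Carries S h g φ ∧ φ y = some x ∧
    (STGe S q y ∧ STGe S y q) ∧ ∀ y' x', φ y' = some x' → STGe S x x')

namespace StarEdge

variable {p q : Fin n} {φ : ISemi n} {x x' y y' : Fin n}

theorem mem (hE : StarEdge S g h p q φ x y) : φ ∈ offDiagonal S g h := by
  rcases hE with ⟨hc, hv, -⟩ | ⟨hc, hv, -⟩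
  · exact mem_offDiagonal hc hv
  · exact offDiagonal_comm ▸ mem_offDiagonal hc hv

theorem not_both (H : ComplementaryIdempotents S g h) (h1 : Carries S g h φ)
    (h2 : Carries S h g φ) (hv : φ x = some y) : False :=
  H.disj (h1.2 _ _ hv).1 (h2.2 _ _ hv).1

theorem left_inj (H : ComplementaryIdempotents S g h) (h1 : StarEdge S g h p q φ x y)
    (h2 : StarEdge S g h p q φ x' y) : x = x' := by
  rcases h1 with ⟨c1, v1, -⟩ | ⟨c1, v1, -⟩ <;> rcases h2 with ⟨c2, v2, -⟩ | ⟨c2, v2, -⟩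
  · exact φ.inj v1 v2
  · exact (not_both H c1 c2 v1).elim
  · exact (not_both H c2 c1 v1).elim
  · exact Option.some.inj (v1.symm.trans v2)

theorem right_inj (H : ComplementaryIdempotents S g h) (h1 : StarEdge S g h p q φ x y)
    (h2 : StarEdge S g h p q φ x y') : y = y' := by
  rcases h1 with ⟨c1, v1, -⟩ | ⟨c1, v1, -⟩ <;> rcases h2 with ⟨c2, v2, -⟩ | ⟨c2, v2, -⟩
  · exact Option.some.inj (v1.symm.trans v2)
  · exact (not_both H c1 c2 v1).elim
  · exact (not_both H c2 c1 v1).elim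
  · exact φ.inj v1 v2

theorem edge (H : ComplementaryIdempotents S g h) (h1 : StarEdge S g h p q φ x y)
    (h2 : StarEdge S g h p q φ x' y') : STGe S x x' ∧ STGe S y y' := by
  rcases h1 with ⟨c1, v1, ⟨k1, m1⟩ | ⟨k1, l1, m1⟩⟩ | ⟨c1, v1, k1, m1⟩ <;>
    rcases h2 with ⟨c2, v2, ⟨k2, m2⟩ | ⟨k2, l2, m2⟩⟩ | ⟨c2, v2, k2, m2⟩
  · exact ⟨m2 _ _ v1 k1.2, H.trans k1.2 k2.1⟩
  · exact (l2 (H.trans (m2 _ _ v1) k1.2)).elim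
  · exact (not_both H c1 c2 v1).elim
  · exact (l1 (H.trans (m1 _ _ v2) k2.2)).elim
  · exact ⟨H.trans k1.2 k2.1, m1 _ _ v2⟩
  · exact (not_both H c1 c2 v1).elim
  · exact (not_both H c2 c1 v1).elim
  · exact (not_both H c2 c1 v1).elim
  · exact ⟨m1 _ _ v2, H.trans k1.2 k2.1⟩

theorem exists_right (H : ComplementaryIdempotents S g h)
    (unmixed : ∀ a b, g a = some a → h b = some b → STGe S a b → ¬STGe S b a)
    (hgp : g p = some p) (hhq : h q = some q) (hpq : STGe S p q)
    (hp : ∀ x, g x = some x → STGe S x q → STGe S x p)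
    (hq : ∀ y, h y = some y → STGe S q y)
    (hx : g x = some x) (hqy : STGe S q y) (hyq : STGe S y q) :
    ∃ φ, StarEdge S g h p q φ x y := by
  have hy : h y = some y := by
    rcases H.cover y with hy | hy
    · exact (unmixed y q hy hhq hyq hqy).elim
    · exact hy
  by_cases hxq : STGe S x q
  · obtain ⟨α, hα, hαx, hα'⟩ := H.exists_level_monotone hx hgp (hp x hx hxq)
    obtain ⟨ψ, hψ, hψp⟩ := H.exists_carries hgp hy (H.trans hpq hqy)
    refine ⟨α.trans ψ, Or.inl ⟨⟨H.sub _ hα.1 _ hψ.1, fun a b hab => ?_⟩,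
      (PEquiv.trans_eq_some _ _ _ _).2 ⟨p, hαx, hψp⟩, Or.inl ⟨⟨hqy, hyq⟩, ?_⟩⟩⟩
    · obtain ⟨c, hc, hcb⟩ := (PEquiv.trans_eq_some _ _ _ _).1 hab
      exact ⟨(hα.2 _ _ hc).1, (hψ.2 _ _ hcb).2⟩
    · intro a b hab hbq
      obtain ⟨c, hc, hcb⟩ := (PEquiv.trans_eq_some _ _ _ _).1 hab
      exact (hα' _ _ hc).1 (hp c (hα.2 _ _ hc).2 (H.trans ⟨ψ, hψ.1, hcb⟩ hbq))
  · obtain ⟨m, ⟨hm, hmq⟩, hmax⟩ := exists_isLeast_of_total (STGe S) H.st.total H.trans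
      (fun a => g a = some a ∧ ¬STGe S a q) ⟨x, hx, hxq⟩
    obtain ⟨ψ, hψ, hψy⟩ := H.symm.exists_carries hy hm (H.trans hyq (H.ge_of_not hmq))
    obtain ⟨α, hα, hαm, hα'⟩ := H.exists_level_monotone hm hx (hmax x ⟨hx, hxq⟩)
    refine ⟨ψ.trans α, Or.inr ⟨⟨H.sub _ hψ.1 _ hα.1, fun a b hab => ?_⟩,
      (PEquiv.trans_eq_some _ _ _ _).2 ⟨m, hψy, hαm⟩, ⟨hqy, hyq⟩, ?_⟩⟩
    · obtain ⟨c, hc, hcb⟩ := (PEquiv.trans_eq_some _ _ _ _).1 hab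
      exact ⟨(hψ.2 _ _ hc).1, (hα.2 _ _ hcb).2⟩
    · intro a b hab
      obtain ⟨c, hc, hcb⟩ := (PEquiv.trans_eq_some _ _ _ _).1 hab
      obtain ⟨ha, hgc⟩ := hψ.2 _ _ hc
      refine (hα' _ _ hcb).2 (hmax c ⟨hgc, fun hcq => ?_⟩)
      exact unmixed c q hgc hhq hcq (H.trans (hq a ha) ⟨ψ, hψ.1, hc⟩)

theorem exists_left (H : ComplementaryIdempotents S g h)
    (unmixed : ∀ a b, g a = some a → h b = some b → STGe S a b → ¬STGe S b a)
    (hgp : g p = some p) (hhq : h q = some q) (hpq : STGe S p q)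
    (hp : ∀ x, g x = some x → STGe S x q → STGe S x p)
    (hq : ∀ y, h y = some y → STGe S q y)
    (hpx : STGe S p x) (hxp : STGe S x p) (hy : h y = some y) :
    ∃ φ, StarEdge S g h p q φ x y := by
  have hx : g x = some x := by
    rcases H.cover x with hx | hx
    · exact hx
    · exact (unmixed p x hgp hx hpx hxp).elim
  by_cases hyq : STGe S y q
  · exact exists_right H unmixed hgp hhq hpq hp hq hx (hq y hy) hyq
  · obtain ⟨ψ, hψ, hψx⟩ := H.exists_carries hx hhq (H.trans hxp hpq)
    obtain ⟨β, hβ, hβq, hβ'⟩ := H.symm.exists_level_monotone hhq hy (hq y hy)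
    refine ⟨ψ.trans β, Or.inl ⟨⟨H.sub _ hψ.1 _ hβ.1, fun a b hab => ?_⟩,
      (PEquiv.trans_eq_some _ _ _ _).2 ⟨q, hψx, hβq⟩, Or.inr ⟨⟨hpx, hxp⟩, hyq, ?_⟩⟩⟩
    · obtain ⟨c, hc, hcb⟩ := (PEquiv.trans_eq_some _ _ _ _).1 hab
      exact ⟨(hψ.2 _ _ hc).1, (hβ.2 _ _ hcb).2⟩
    · intro a b hab
      obtain ⟨c, hc, hcb⟩ := (PEquiv.trans_eq_some _ _ _ _).1 hab
      exact (hβ' _ _ hcb).2 (hq c (hψ.2 _ _ hc).2)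

end StarEdge

theorem sub_ncard_block_le_of_top (H : ComplementaryIdempotents S g h)
    (hne : ∃ y, h y = some y) {u : Fin n} (hu : g u = some u) (hmax : ∀ x, STGe S u x)
    (r : Fin n) : n - (STBlock S r).ncard ≤ (offDiagonal S g h).ncard := by
  by_cases unmixed : ∀ a b, g a = some a → h b = some b → STGe S a b → ¬STGe S b a
  · obtain ⟨q, hhq, hq⟩ := exists_isLeast_of_total (STGe S) H.st.total H.trans _ hne
    obtain ⟨p, ⟨hgp, hpq⟩, hp⟩ := exists_isLeast_of_total (fun x y => STGe S y x)
      (fun x y => H.st.total y x) (fun h1 h2 => H.trans h2 h1)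
      (fun a => g a = some a ∧ STGe S a q) ⟨u, hu, hmax q⟩
    have hp' := fun x hx hxq => hp x ⟨hx, hxq⟩
    rcases H.cover r with hr | hr
    · exact H.sub_ncard_block_le (E := StarEdge S g h p q) StarEdge.mem (StarEdge.left_inj H)
        (StarEdge.right_inj H) (StarEdge.edge H)
        (fun x y hx h1 h2 =>
          StarEdge.exists_right H unmixed hgp hhq hpq hp' hq hx h1 h2)
        (fun y hy =>
          StarEdge.exists_left H unmixed hgp hhq hpq hp' hq (H.refl p) (H.refl p) hy) hr
    · exact H.symm.sub_ncard_block_le (E := fun φ x y => StarEdge S g h p q φ y x)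
        (p := q) (q := p) StarEdge.mem (StarEdge.right_inj H) (StarEdge.left_inj H)
        (fun h1 h2 => (StarEdge.edge H h1 h2).symm)
        (fun x y hx h1 h2 =>
          StarEdge.exists_left H unmixed hgp hhq hpq hp' hq h1 h2 hx)
        (fun y hy =>
          StarEdge.exists_right H unmixed hgp hhq hpq hp' hq hy (H.refl q) (H.refl q)) hr
  · push Not at unmixed
    obtain ⟨a, b, ha, hb, hab, hba⟩ := unmixed
    exact (Nat.sub_le _ _).trans (H.le_ncard_offDiagonal_of_mixed ha hb hab hba hu hmax)

end ComplementaryIdempotents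

theorem PEquiv.exists_fixed_of_ne_bot {X : Type*} {g : PEquiv X X} (hg : g.trans g = g)
    (hg0 : g ≠ ⊥) : ∃ x, g x = some x := by
  by_contra! hno
  refine hg0 (PEquiv.ext fun x => Option.ext fun y => ?_)
  constructor
  · intro hxy
    obtain rfl := PEquiv.eq_of_trans_self_eq hg hxy
    exact (hno x hxy).elim
  · intro hxy
    simp at hxy

theorem complementaryIdempotents_of_only_two {n : ℕ} {S : Set (ISemi n)}
    (hsub : IsSubsemigroup S) (hsing : ∀ φ ∈ S, IsSingular φ) (hst : Semitransitive S)
    {g h : ISemi n} (hg : g ∈ S) (hh : h ∈ S)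
    (hgid : g.trans g = g) (hhid : h.trans h = h)
    (honly : ∀ e ∈ S, e.trans e = e → e ≠ ⊥ → e = g ∨ e = h) :
    ComplementaryIdempotents S g h := by
  have only : ∀ {x}, ∀ e ∈ S, e.trans e = e → e x = some x → e = g ∨ e = h := by
    intro x e he hid hx
    refine honly e he hid ?_
    rintro rfl
    simp at hx
  have cover : ∀ x, g x = some x ∨ h x = some x := by
    intro x
    obtain ⟨φ, hφ, hφx⟩ : ∃ φ ∈ S, φ x = some x := by simpa using hst x x
    obtain ⟨β, hβ, hid, hfix⟩ := exists_idempotent_of_fixed hsub hφ hφx ⟨φ, hφ, hφx⟩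
    rcases only _ (hsub _ hφ _ hβ) hid hfix with he | he
    · exact Or.inl (he ▸ hfix)
    · exact Or.inr (he ▸ hfix)
  have disj : ∀ {x}, g x = some x → h x = some x → False := by
    intro x hgx hhx
    have hval : ∀ {a b}, (g.trans h) a = some b → a = b ∧ g a = some a ∧ h a = some a := by
      intro a b hab
      obtain ⟨c, hc, hcb⟩ := (PEquiv.trans_eq_some _ _ _ _).1 hab
      obtain rfl := PEquiv.eq_of_trans_self_eq hgid hc
      obtain rfl := PEquiv.eq_of_trans_self_eq hhid hcb
      exact ⟨rfl, hc, hcb⟩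
    have hfix : ∀ {a}, g a = some a → h a = some a → (g.trans h) a = some a :=
      fun h1 h2 => (PEquiv.trans_eq_some _ _ _ _).2 ⟨_, h1, h2⟩
    have hid : (g.trans h).trans (g.trans h) = g.trans h := by
      refine PEquiv.ext fun a => Option.ext fun b => ?_
      rw [PEquiv.trans_eq_some]
      constructor
      · rintro ⟨c, hc, hcb⟩
        obtain rfl := (hval hc).1
        exact hcb
      · intro hab
        obtain ⟨rfl, -⟩ := hval hab
        exact ⟨a, hab, hab⟩
    rcases only _ (hsub _ hg _ hh) hid (hfix hgx hhx) with he | he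
    · obtain ⟨z, hz⟩ := hsing h hh
      rcases cover z with hz' | hz'
      · rw [← he] at hz'
        simp [(hval hz').2.2] at hz
      · simp [hz'] at hz
    · obtain ⟨z, hz⟩ := hsing g hg
      rcases cover z with hz' | hz'
      · simp [hz'] at hz
      · rw [← he] at hz'
        simp [(hval hz').2.1] at hz
  exact
    { sub := hsub
      st := hst
      left_mem := hg
      right_mem := hh
      left_eq := PEquiv.eq_of_trans_self_eq hgid
      right_eq := PEquiv.eq_of_trans_self_eq hhid
      cover := cover
      disj := disj
      left_undo := fun hα hx hxz hzx => undo_of_unique_idempotent hsub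
        (fun e he hid hex => (only e he hid hex).resolve_right
          (by rintro rfl; exact disj hx hex)) hα hxz hzx
      right_undo := fun hα hx hxz hzx => undo_of_unique_idempotent hsub
        (fun e he hid hex => (only e he hid hex).resolve_left
          (by rintro rfl; exact disj hex hx)) hα hxz hzx }

/-- with `g, h` the two distinct non-zero idempotents of a
semitransitive subsemigroup `S` of the singular part with `|S| ≤ 2n`, and `t`
the minimal cardinality of a transitivity block, the set
`N = (gSh ∪ hSg) \ {0}` has at least `n - t` elements. -/
theorem stmt8 (n : ℕ) (hn : 1 ≤ n) (S : Set (ISemi n))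
    (hsub : IsSubsemigroup S)
    (hsing : ∀ φ ∈ S, IsSingular φ)
    (hst : Semitransitive S)
    (hcard : S.ncard ≤ 2 * n)
    (g h : ISemi n) (hg : g ∈ S) (hh : h ∈ S) (hgh : g ≠ h)
    (hgid : g.trans g = g) (hhid : h.trans h = h) (hg0 : g ≠ ⊥) (hh0 : h ≠ ⊥)
    (honly : ∀ e ∈ S, e.trans e = e → e ≠ ⊥ → e = g ∨ e = h)
    (t : ℕ)
    (ht_le : ∀ x : Fin n, t ≤ (STBlock S x).ncard)
    (ht_ex : ∃ x : Fin n, (STBlock S x).ncard = t) :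
    n - t ≤
      (({φ : ISemi n | ∃ σ ∈ S, φ = g.trans (σ.trans h) ∨ φ = h.trans (σ.trans g)}
        \ {⊥}).ncard) := by
  have H := complementaryIdempotents_of_only_two hsub hsing hst hg hh hgid hhid honly
  obtain ⟨r, rfl⟩ := ht_ex
  obtain ⟨u, -, hmax⟩ := exists_isLeast_of_total (STGe S) hst.total (STGe.trans hsub)
    (fun _ => True) ⟨⟨0, hn⟩, trivial⟩
  change _ ≤ (ComplementaryIdempotents.offDiagonal S g h).ncard
  rcases H.cover u with hu | hu
  · exact H.sub_ncard_block_le_of_top (PEquiv.exists_fixed_of_ne_bot hhid hh0) hu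
      (fun x => hmax x trivial) r
  · rw [ComplementaryIdempotents.offDiagonal_comm]
    exact H.symm.sub_ncard_block_le_of_top (PEquiv.exists_fixed_of_ne_bot hgid hg0) hu
      (fun x => hmax x trivial) r
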